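/- Let w0 ∈ S_n be the order-reversing permutation (w0(j) = n − 1 − j) and let r be a reduced word for w0. Then for every index i with i + 1 < n and every f ∈ R: π_i(π_r f) = π_r f and θ_i(π_r f) = 0. -/

import Mathlib

open MvPolynomial

noncomputable section

/-- Valid indices: `i` with `i + 1 < n`. -/
abbrev Idx (n : ℕ) := {i : ℕ // i + 1 < n}

/-- The element `i` of `Fin n`. -/
def idxLow {n : ℕ} (i : Idx n) : Fin n := ⟨i.1, Nat.lt_of_succ_lt i.2⟩

/-- The element `i + 1` of `Fin n`. -/
def idxHigh {n : ℕ} (i : Idx n) : Fin n := ⟨i.1 + 1, i.2⟩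

/-- The simple transposition `s_i = (i, i+1)` in `S_n`. -/
def simpleT {n : ℕ} (i : Idx n) : Equiv.Perm (Fin n) := Equiv.swap (idxLow i) (idxHigh i)

/-- The action of `s_i` on polynomials, renaming the variables `X i` and `X (i+1)`. -/
def sOp {n : ℕ} (i : Idx n) (f : MvPolynomial (Fin n) ℤ) : MvPolynomial (Fin n) ℤ :=
  rename ⇑(simpleT i) f

/-- The type of families of operators indexed by valid indices. -/
abbrev DD (n : ℕ) := Idx n → MvPolynomial (Fin n) ℤ → MvPolynomial (Fin n) ℤ

/-- `D` is the family of divided difference operators `∂_i`: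
`(X i − X (i+1)) * ∂_i f = f − s_i f` (this determines `∂_i f` uniquely since
`MvPolynomial (Fin n) ℤ` is an integral domain). -/
def IsDividedDiff {n : ℕ} (D : DD n) : Prop :=
  ∀ (i : Idx n) (f : MvPolynomial (Fin n) ℤ),
    (X (idxLow i) - X (idxHigh i)) * D i f = f - sOp i f

/-- `π_i f = ∂_i (X i * f)`. -/
def piOp {n : ℕ} (D : DD n) (i : Idx n) (f : MvPolynomial (Fin n) ℤ) :
    MvPolynomial (Fin n) ℤ :=
  D i (X (idxLow i) * f)

/-- `θ_i f = X (i+1) * ∂_i f`. -/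
def thetaOp {n : ℕ} (D : DD n) (i : Idx n) (f : MvPolynomial (Fin n) ℤ) :
    MvPolynomial (Fin n) ℤ :=
  X (idxHigh i) * D i f

/-- `θ_w = θ_{i_1} ∘ ⋯ ∘ θ_{i_k}` for a word `w = (i_1, …, i_k)`. -/
def thetaWord {n : ℕ} (D : DD n) : List (Idx n) → MvPolynomial (Fin n) ℤ → MvPolynomial (Fin n) ℤ
  | [], f => f
  | i :: w, f => thetaOp D i (thetaWord D w f)

/-- `π_w = π_{i_1} ∘ ⋯ ∘ π_{i_k}` for a word `w = (i_1, …, i_k)`. -/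
def piWord {n : ℕ} (D : DD n) : List (Idx n) → MvPolynomial (Fin n) ℤ → MvPolynomial (Fin n) ℤ
  | [], f => f
  | i :: w, f => piOp D i (piWord D w f)

/-- The permutation `s_{i_1} · ⋯ · s_{i_k}` represented by a word. -/
def wordProd {n : ℕ} (w : List (Idx n)) : Equiv.Perm (Fin n) := (w.map simpleT).prod

/-- `w` is a reduced word for `σ`: it represents `σ` and no shorter word does. -/
def IsReducedWord {n : ℕ} (w : List (Idx n)) (σ : Equiv.Perm (Fin n)) : Prop :=
  wordProd w = σ ∧ ∀ w' : List (Idx n), wordProd w' = σ → w.length ≤ w'.length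

/-- The length `l(σ)`: the length of any reduced word for `σ`. -/
def len {n : ℕ} (σ : Equiv.Perm (Fin n)) : ℕ :=
  sInf {k | ∃ w : List (Idx n), wordProd w = σ ∧ w.length = k}

/-- Strong Bruhat order: some reduced word of `γ` is a (not necessarily contiguous)
subword of some reduced word of `σ`. -/
def BruhatLE {n : ℕ} (γ σ : Equiv.Perm (Fin n)) : Prop :=
  ∃ u v : List (Idx n), IsReducedWord u γ ∧ IsReducedWord v σ ∧ u.Sublist v

/-- The monomial `x^λ = ∏ j, (X j)^(λ j)`. -/
def xpow {n : ℕ} (lam : Fin n → ℕ) : MvPolynomial (Fin n) ℤ := ∏ j, X j ^ lam j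

/-- `f` is atom-positive: it lies in the additive submonoid generated by the
Demazure atoms `θ_w (x^λ)` with `w` a reduced word and `λ` a partition. -/
def AtomPos {n : ℕ} (D : DD n) (f : MvPolynomial (Fin n) ℤ) : Prop :=
  f ∈ AddSubmonoid.closure {g : MvPolynomial (Fin n) ℤ |
    ∃ (w : List (Idx n)) (σ : Equiv.Perm (Fin n)) (lam : Fin n → ℕ),
      IsReducedWord w σ ∧ Antitone lam ∧ g = thetaWord D w (xpow lam)}

/-- `f` is key-positive: it lies in the additive submonoid generated by the
key polynomials `π_w (x^λ)` with `w` a word and `λ` a partition. -/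
def KeyPos {n : ℕ} (D : DD n) (f : MvPolynomial (Fin n) ℤ) : Prop :=
  f ∈ AddSubmonoid.closure {g : MvPolynomial (Fin n) ℤ |
    ∃ (w : List (Idx n)) (lam : Fin n → ℕ),
      Antitone lam ∧ g = piWord D w (xpow lam)}

/-- The number of inversions of a permutation. -/
def invNum {n : ℕ} (σ : Equiv.Perm (Fin n)) : ℕ :=
  (Finset.univ.filter (fun p : Fin n × Fin n => p.1 < p.2 ∧ σ p.2 < σ p.1)).card

end

variable {n : ℕ}

lemma idxLow_lt_idxHigh (i : Idx n) : idxLow i < idxHigh i := by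
  simp [idxLow, idxHigh, Fin.lt_def]

lemma simpleT_low (i : Idx n) : simpleT i (idxLow i) = idxHigh i :=
  Equiv.swap_apply_left _ _

lemma simpleT_high (i : Idx n) : simpleT i (idxHigh i) = idxLow i :=
  Equiv.swap_apply_right _ _

lemma simpleT_of_ne {i : Idx n} {a : Fin n} (hl : a ≠ idxLow i) (hh : a ≠ idxHigh i) :
    simpleT i a = a :=
  Equiv.swap_apply_of_ne_of_ne hl hh

lemma simpleT_mul_self (i : Idx n) : simpleT i * simpleT i = 1 :=
  Equiv.swap_mul_self _ _

lemma simpleT_mul_cancel_left (i : Idx n) (σ : Equiv.Perm (Fin n)) :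
    simpleT i * (simpleT i * σ) = σ := by
  rw [← mul_assoc, simpleT_mul_self, one_mul]

lemma simpleT_inv (i : Idx n) : (simpleT i)⁻¹ = simpleT i :=
  Equiv.swap_inv _ _

lemma wordProd_cons (i : Idx n) (w : List (Idx n)) :
    wordProd (i :: w) = simpleT i * wordProd w := by
  simp [wordProd]

/-- A simple transposition reverses the order of no pair other than its own. -/
lemma eq_of_simpleT_le {i : Idx n} {a b : Fin n} (hab : a < b)
    (h : simpleT i b ≤ simpleT i a) : a = idxLow i ∧ b = idxHigh i := by
  obtain ⟨i, hi⟩ := i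
  simp only [simpleT, Equiv.swap_apply_def, idxLow, idxHigh] at *
  simp only [Fin.ext_iff, Fin.lt_def, Fin.le_def] at *
  split_ifs at h <;> simp_all <;> omega

/-- The exchange property. -/
lemma exists_shorter_word (u : List (Idx n)) (a b : Fin n) (hab : a < b)
    (h : (wordProd u)⁻¹ b < (wordProd u)⁻¹ a) :
    ∃ u' : List (Idx n), u'.length + 1 = u.length ∧
      wordProd u' = Equiv.swap a b * wordProd u := by
  induction u generalizing a b with
  | nil => simp [wordProd] at h; exact absurd h hab.not_gt
  | cons j v ih =>
    rcases lt_or_ge (simpleT j a) (simpleT j b) with hj | hj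
    · obtain ⟨v', hv', hp⟩ := ih _ _ hj (by
        simpa [wordProd_cons, mul_inv_rev, simpleT_inv] using h)
      refine ⟨j :: v', by simp [hv'], ?_⟩
      rw [wordProd_cons, wordProd_cons, hp, ← mul_assoc, ← mul_assoc,
        Equiv.mul_swap_eq_swap_mul]
      simp [← Equiv.Perm.mul_apply, simpleT_mul_self]
    · obtain ⟨rfl, rfl⟩ := eq_of_simpleT_le hab hj
      refine ⟨v, rfl, ?_⟩
      rw [wordProd_cons]
      exact (simpleT_mul_cancel_left j _).symm

/-- `i` is a left descent of `σ`. -/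
def IsLeftDesc (i : Idx n) (σ : Equiv.Perm (Fin n)) : Prop :=
  σ⁻¹ (idxHigh i) < σ⁻¹ (idxLow i)

lemma isLeftDesc_simpleT_mul_iff (i j : Idx n) (σ : Equiv.Perm (Fin n)) :
    IsLeftDesc j (simpleT i * σ) ↔
      σ⁻¹ (simpleT i (idxHigh j)) < σ⁻¹ (simpleT i (idxLow j)) := by
  simp [IsLeftDesc, mul_inv_rev, simpleT_inv]

lemma IsReducedWord.length_eq {u v : List (Idx n)} {σ : Equiv.Perm (Fin n)}
    (hu : IsReducedWord u σ) (hv : IsReducedWord v σ) : u.length = v.length :=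
  le_antisymm (hu.2 _ hv.1) (hv.2 _ hu.1)

lemma IsReducedWord.of_length_le {u v : List (Idx n)} {σ : Equiv.Perm (Fin n)}
    (hu : IsReducedWord u σ) (hv : wordProd v = σ) (h : v.length ≤ u.length) :
    IsReducedWord v σ :=
  ⟨hv, fun w hw => h.trans (hu.2 w hw)⟩

lemma IsReducedWord.tail {i : Idx n} {u : List (Idx n)} {σ : Equiv.Perm (Fin n)}
    (h : IsReducedWord (i :: u) σ) : IsReducedWord u (simpleT i * σ) := by
  refine ⟨by rw [← h.1, wordProd_cons, simpleT_mul_cancel_left],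
    fun w hw => ?_⟩
  have := h.2 (i :: w) (by rw [wordProd_cons, hw, simpleT_mul_cancel_left])
  simpa using this

lemma IsReducedWord.exists_cons {i : Idx n} {u : List (Idx n)} {σ : Equiv.Perm (Fin n)}
    (h : IsReducedWord u σ) (hi : IsLeftDesc i σ) : ∃ v, IsReducedWord (i :: v) σ := by
  obtain ⟨v, hv, hp⟩ := exists_shorter_word u _ _ (idxLow_lt_idxHigh i) (by rw [h.1]; exact hi)
  refine ⟨v, h.of_length_le ?_ (by simp [hv])⟩
  rw [wordProd_cons, hp, h.1]
  exact simpleT_mul_cancel_left i σ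

lemma IsReducedWord.isLeftDesc {i : Idx n} {u : List (Idx n)} {σ : Equiv.Perm (Fin n)}
    (h : IsReducedWord (i :: u) σ) : IsLeftDesc i σ := by
  by_contra hi
  have hd : IsLeftDesc i (simpleT i * σ) := by
    rw [isLeftDesc_simpleT_mul_iff, simpleT_high, simpleT_low]
    refine lt_of_le_of_ne (not_lt.mp hi) fun he => ?_
    exact (idxLow_lt_idxHigh i).ne (σ⁻¹.injective he)
  obtain ⟨v, hv⟩ := h.tail.exists_cons hd
  have h1 := hv.tail.1
  rw [simpleT_mul_cancel_left] at h1
  have h2 := h.2 v h1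
  have h3 := h.tail.length_eq hv
  simp at h2 h3
  omega

lemma sOp_sub_mul (i : Idx n) (f g : MvPolynomial (Fin n) ℤ) (a b : Fin n) :
    sOp i (X a * f - X b * g) =
      X (simpleT i a) * sOp i f - X (simpleT i b) * sOp i g := by
  simp [sOp]

lemma sOp_sub_X_mul (i : Idx n) (f : MvPolynomial (Fin n) ℤ) (a b : Fin n) :
    sOp i ((X a - X b) * f) = (X (simpleT i a) - X (simpleT i b)) * sOp i f := by
  simp [sOp]

lemma sOp_sOp (i j : Idx n) (f : MvPolynomial (Fin n) ℤ) :
    sOp i (sOp j f) = rename ⇑(simpleT i * simpleT j) f := by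
  simp [sOp, rename_rename, Equiv.Perm.coe_mul]

lemma sOp_sOp_self (i : Idx n) (f : MvPolynomial (Fin n) ℤ) : sOp i (sOp i f) = f := by
  simp [sOp_sOp, simpleT_mul_self]

lemma X_sub_X_ne_zero {a b : Fin n} (h : a ≠ b) :
    (X a - X b : MvPolynomial (Fin n) ℤ) ≠ 0 :=
  sub_ne_zero.mpr fun he => h (X_injective he)

variable {D : DD n}

lemma piOp_spec (hD : IsDividedDiff D) (i : Idx n) (f : MvPolynomial (Fin n) ℤ) :
    (X (idxLow i) - X (idxHigh i)) * piOp D i f =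
      X (idxLow i) * f - X (idxHigh i) * sOp i f := by
  rw [piOp, hD]
  simp [sOp, simpleT_low]

lemma sOp_piOp_spec (hD : IsDividedDiff D) (k i : Idx n) (f : MvPolynomial (Fin n) ℤ) :
    (X (simpleT k (idxLow i)) - X (simpleT k (idxHigh i))) * sOp k (piOp D i f) =
      X (simpleT k (idxLow i)) * sOp k f - X (simpleT k (idxHigh i)) * sOp k (sOp i f) := by
  rw [← sOp_sub_X_mul, piOp_spec hD, sOp_sub_mul]

lemma sOp_piOp_self (hD : IsDividedDiff D) (i : Idx n) (f : MvPolynomial (Fin n) ℤ) :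
    sOp i (piOp D i f) = piOp D i f := by
  have h := sOp_piOp_spec hD i i f
  rw [simpleT_low, simpleT_high, sOp_sOp_self] at h
  apply mul_left_cancel₀ (X_sub_X_ne_zero (idxLow_lt_idxHigh i).ne)
  linear_combination -h - piOp_spec hD i f

lemma piOp_eq_self (hD : IsDividedDiff D) {i : Idx n} {f : MvPolynomial (Fin n) ℤ}
    (h : sOp i f = f) : piOp D i f = f := by
  apply mul_left_cancel₀ (X_sub_X_ne_zero (idxLow_lt_idxHigh i).ne)
  rw [piOp_spec hD, h, sub_mul]

lemma thetaOp_eq_zero (hD : IsDividedDiff D) {i : Idx n} {f : MvPolynomial (Fin n) ℤ}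
    (h : sOp i f = f) : thetaOp D i f = 0 := by
  have h0 : D i f = 0 := by
    apply mul_left_cancel₀ (X_sub_X_ne_zero (idxLow_lt_idxHigh i).ne)
    rw [hD, h, sub_self, mul_zero]
  rw [thetaOp, h0, mul_zero]

lemma simpleT_of_far {i j : Idx n} (h : i.1 + 1 < j.1) :
    (simpleT i (idxLow j) = idxLow j ∧ simpleT i (idxHigh j) = idxHigh j) ∧
      simpleT j (idxLow i) = idxLow i ∧ simpleT j (idxHigh i) = idxHigh i := by
  refine ⟨⟨simpleT_of_ne ?_ ?_, simpleT_of_ne ?_ ?_⟩, simpleT_of_ne ?_ ?_, simpleT_of_ne ?_ ?_⟩ <;>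
    simp only [ne_eq, idxLow, idxHigh, Fin.ext_iff] <;> omega

lemma simpleT_comm {i j : Idx n} (h : i.1 + 1 < j.1) :
    simpleT i * simpleT j = simpleT j * simpleT i := by
  obtain ⟨⟨h1, h2⟩, -⟩ := simpleT_of_far h
  conv_lhs => rw [simpleT.eq_def j, Equiv.mul_swap_eq_swap_mul, h1, h2]
  rfl

lemma piOp_comm (hD : IsDividedDiff D) {i j : Idx n} (h : i.1 + 1 < j.1)
    (f : MvPolynomial (Fin n) ℤ) :
    piOp D i (piOp D j f) = piOp D j (piOp D i f) := by
  obtain ⟨⟨h1, h2⟩, h3, h4⟩ := simpleT_of_far h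
  apply mul_left_cancel₀ (X_sub_X_ne_zero (idxLow_lt_idxHigh i).ne)
  apply mul_left_cancel₀ (X_sub_X_ne_zero (idxLow_lt_idxHigh j).ne)
  have e1 := piOp_spec hD i (piOp D j f)
  have e2 := piOp_spec hD j (piOp D i f)
  have e3 := piOp_spec hD i f
  have e4 := piOp_spec hD j f
  have e5 := sOp_piOp_spec hD i j f
  have e6 := sOp_piOp_spec hD j i f
  rw [h1, h2] at e5
  rw [h3, h4, sOp_sOp, ← simpleT_comm h, ← sOp_sOp] at e6
  linear_combination (X (idxLow j) - X (idxHigh j)) * e1 - (X (idxLow i) - X (idxHigh i)) * e2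
    + X (idxLow i) * e4 - X (idxHigh i) * e5 - X (idxLow j) * e3 + X (idxHigh j) * e6

lemma simpleT_of_adj {i j : Idx n} (h : j.1 = i.1 + 1) :
    idxLow j = idxHigh i ∧ simpleT i (idxHigh j) = idxHigh j ∧
      simpleT j (idxLow i) = idxLow i := by
  refine ⟨by simp [idxLow, idxHigh, h], simpleT_of_ne ?_ ?_, simpleT_of_ne ?_ ?_⟩ <;>
    simp only [ne_eq, idxLow, idxHigh, Fin.ext_iff] <;> omega

lemma simpleT_braid {i j : Idx n} (h : j.1 = i.1 + 1) :
    simpleT i * simpleT j * simpleT i = simpleT j * simpleT i * simpleT j := by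
  obtain ⟨h1, h2, h3⟩ := simpleT_of_adj h
  have e1 : simpleT i * simpleT j = Equiv.swap (idxLow i) (idxHigh j) * simpleT i := by
    conv_lhs => rw [simpleT.eq_def j, Equiv.mul_swap_eq_swap_mul, h2, h1, simpleT_high]
  have e2 : simpleT j * simpleT i = Equiv.swap (idxLow i) (idxHigh j) * simpleT j := by
    conv_lhs => rw [simpleT.eq_def i, Equiv.mul_swap_eq_swap_mul, h3, ← h1, simpleT_low]
  rw [e1, e2, mul_assoc, mul_assoc, simpleT_mul_self, simpleT_mul_self]

lemma piOp_braid (hD : IsDividedDiff D) {i j : Idx n} (h : j.1 = i.1 + 1)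
    (f : MvPolynomial (Fin n) ℤ) :
    piOp D i (piOp D j (piOp D i f)) = piOp D j (piOp D i (piOp D j f)) := by
  obtain ⟨h1, h2, h3⟩ := simpleT_of_adj h
  have hji := simpleT_low j
  have hjh := simpleT_high j
  rw [h1] at hji hjh
  have hij : idxLow i ≠ idxHigh i := (idxLow_lt_idxHigh i).ne
  have hjk : idxHigh i ≠ idxHigh j := h1 ▸ (idxLow_lt_idxHigh j).ne
  have hik : idxLow i ≠ idxHigh j :=
    ((idxLow_lt_idxHigh i).trans (h1 ▸ idxLow_lt_idxHigh j)).ne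
  have hs : sOp i (sOp j (sOp i f)) = sOp j (sOp i (sOp j f)) := by
    have := congrArg (fun σ : Equiv.Perm (Fin n) => rename ⇑σ f) (simpleT_braid h)
    simpa [sOp, rename_rename, Equiv.Perm.coe_mul, Function.comp_assoc] using this
  have a1 := piOp_spec hD i f
  have a2 := piOp_spec hD j (piOp D i f)
  have a3 := piOp_spec hD i (piOp D j (piOp D i f))
  have a4 := sOp_piOp_spec hD j i f
  have a5 := sOp_piOp_spec hD i j (piOp D i f)
  have a6 := congrArg (sOp i) a4
  have b1 := piOp_spec hD j f
  have b2 := piOp_spec hD i (piOp D j f)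
  have b3 := piOp_spec hD j (piOp D i (piOp D j f))
  have b4 := sOp_piOp_spec hD i j f
  have b5 := sOp_piOp_spec hD j i (piOp D j f)
  have b6 := congrArg (sOp j) b4
  simp only [sOp_sub_mul, sOp_sub_X_mul, sOp_piOp_self hD, h1, h2, h3, hji, hjh,
    simpleT_low, simpleT_high, hs] at a1 a2 a3 a4 a5 a6 b1 b2 b3 b4 b5 b6
  have hx := X_sub_X_ne_zero hij
  have hy := X_sub_X_ne_zero hjk
  have hz := X_sub_X_ne_zero hik
  generalize (X (idxLow i) : MvPolynomial (Fin n) ℤ) = x at *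
  generalize (X (idxHigh i) : MvPolynomial (Fin n) ℤ) = y at *
  generalize (X (idxHigh j) : MvPolynomial (Fin n) ℤ) = z at *
  apply mul_left_cancel₀ (mul_ne_zero (pow_ne_zero 2 (mul_ne_zero hx hy)) hz)
  linear_combination
    (y - z) * (x - y) * ((x - z) * (y - z) * a3 + x * (x - z) * a2 - y * (y - z) * a5
      + x * y * a1 - x * z * a4 + y * z * a6)
    - (x - y) * (y - z) * ((x - y) * (x - z) * b3 + y * (x - z) * b2 - z * (x - y) * b5
      + x ^ 2 * b1 - y ^ 2 * b4 + z ^ 2 * b6)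

/-- Matsumoto's theorem for the operators `π_w`. -/
lemma piWord_eq_of_isReducedWord (hD : IsDividedDiff D) (f : MvPolynomial (Fin n) ℤ)
    {u v : List (Idx n)} {σ : Equiv.Perm (Fin n)}
    (hu : IsReducedWord u σ) (hv : IsReducedWord v σ) :
    piWord D u f = piWord D v f := by
  induction hk : u.length generalizing u v σ with
  | zero =>
    have hv0 := hu.length_eq hv
    rw [hk] at hv0
    rw [List.length_eq_zero_iff.mp hk, List.length_eq_zero_iff.mp hv0.symm]
  | succ k ih =>
    have hlen := hu.length_eq hv
    obtain ⟨i, u, rfl⟩ := List.exists_cons_of_length_eq_add_one hk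
    obtain ⟨j, v, rfl⟩ := List.exists_cons_of_length_eq_add_one (hlen.symm.trans hk)
    simp only [List.length_cons, Nat.add_right_cancel_iff] at hk hlen
    wlog hij : i.1 ≤ j.1 generalizing i j u v
    · exact (this _ _ hv _ _ hu (hlen ▸ hk) hlen.symm (le_of_not_ge hij)).symm
    have hi := hu.isLeftDesc
    have hj := hv.isLeftDesc
    rcases hij.eq_or_lt with hij | hij
    · obtain rfl := Subtype.ext hij
      exact congrArg (piOp D i) (ih hu.tail hv.tail hk)
    rcases (Nat.succ_le_of_lt hij).eq_or_lt with hij | hij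
    · have hij : j.1 = i.1 + 1 := hij.symm
      obtain ⟨h1, h2, h3⟩ := simpleT_of_adj hij
      have hji := simpleT_low j
      rw [h1] at hji
      have hd : IsLeftDesc j (simpleT i * σ) := by
        rw [isLeftDesc_simpleT_mul_iff, h2, h1, simpleT_high]
        rw [IsLeftDesc, h1] at hj
        exact hj.trans hi
      obtain ⟨w, hw⟩ := hu.tail.exists_cons hd
      have hd' : IsLeftDesc i (simpleT j * (simpleT i * σ)) := by
        rw [isLeftDesc_simpleT_mul_iff, h3, hji, mul_inv_rev, simpleT_inv,
          Equiv.Perm.mul_apply, Equiv.Perm.mul_apply, h2, simpleT_low]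
        rw [IsLeftDesc, h1] at hj
        exact hj
      obtain ⟨z, hz⟩ := hw.tail.exists_cons hd'
      have hzp := hz.tail.1
      have hl := hw.tail.length_eq hz
      have hl' := hu.tail.length_eq hw
      simp only [List.length_cons] at hl hl'
      have hjiz : IsReducedWord (j :: i :: z) (simpleT i * σ) :=
        hw.of_length_le (by rw [wordProd_cons, hz.1, simpleT_mul_cancel_left])
          (by simp [hl])
      have hijz : IsReducedWord (i :: j :: z) (simpleT j * σ) := by
        refine hv.tail.of_length_le ?_ (by simp only [List.length_cons]; omega)
        have hb : simpleT i * (simpleT j * (simpleT i * σ)) =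
            simpleT j * (simpleT i * (simpleT j * σ)) := by
          simpa only [mul_assoc] using congrArg (· * σ) (simpleT_braid hij)
        rw [wordProd_cons, wordProd_cons, hzp, hb, simpleT_mul_cancel_left,
          simpleT_mul_cancel_left]
      change piOp D i (piWord D u f) = piOp D j (piWord D v f)
      rw [ih hu.tail hjiz hk, ih hv.tail hijz (hlen ▸ hk)]
      exact piOp_braid hD hij _
    · have hij : i.1 + 1 < j.1 := hij
      obtain ⟨⟨h1, h2⟩, -⟩ := simpleT_of_far hij
      have hd : IsLeftDesc j (simpleT i * σ) := by
        rw [isLeftDesc_simpleT_mul_iff, h1, h2]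
        exact hj
      obtain ⟨z, hz⟩ := hu.tail.exists_cons hd
      have hl := hu.tail.length_eq hz
      simp only [List.length_cons] at hl
      have hiz : IsReducedWord (i :: z) (simpleT j * σ) := by
        refine hv.tail.of_length_le ?_ (by simp only [List.length_cons]; omega)
        rw [wordProd_cons, hz.tail.1, ← mul_assoc, ← mul_assoc, simpleT_comm hij,
          mul_assoc (simpleT j), simpleT_mul_self, mul_one]
      change piOp D i (piWord D u f) = piOp D j (piWord D v f)
      rw [ih hu.tail hz hk, ih hv.tail hiz (hlen ▸ hk)]
      exact piOp_comm hD hij _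

lemma isLeftDesc_revPerm (i : Idx n) : IsLeftDesc i (Fin.revPerm : Equiv.Perm (Fin n)) := by
  change Fin.rev (idxHigh i) < Fin.rev (idxLow i)
  exact Fin.rev_lt_rev.mpr (idxLow_lt_idxHigh i)

/-- `π_i π_{w0} = π_{w0}` and `θ_i π_{w0} = 0` for the longest element `w0`. -/
theorem stmt15 (n : ℕ) (D : DD n) (hD : IsDividedDiff D)
    (r : List (Idx n)) (hr : IsReducedWord r (Fin.revPerm : Equiv.Perm (Fin n)))
    (i : Idx n) (f : MvPolynomial (Fin n) ℤ) :
    piOp D i (piWord D r f) = piWord D r f ∧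
      thetaOp D i (piWord D r f) = 0 := by
  obtain ⟨v, hv⟩ := hr.exists_cons (isLeftDesc_revPerm i)
  rw [piWord_eq_of_isReducedWord hD f hr hv]
  have hs : sOp i (piWord D (i :: v) f) = piWord D (i :: v) f := sOp_piOp_self hD i _
  exact ⟨piOp_eq_self hD hs, thetaOp_eq_zero hD hs⟩
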